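/- arXiv:1503.02701 — 7 statements merged into one kernel-verified Lean document; each statement's English description precedes it below -/
import Mathlib

section
/- For permutations σ of {1,…,n} and τ of {1,…,k} and any 1 ≤ i ≤ n, the insertion satisfies the two factorizations σ ∘_i τ = (σ ∘_i id_k) ∘ (id_n ∘_i τ) and σ ∘_i τ = (id_n ∘_{σ(i)} τ) ∘ (σ ∘_i id_k), where ∘ on the right-hand sides denotes composition of permutations as functions. In particular (σ ∘_i id_k) ∘ (id_n ∘_i τ) = (id_n ∘_{σ(i)} τ) ∘ (σ ∘_i id_k). -/
/-- The insertion `σ ∘ᵢ τ` of a permutation `τ` of `{1,…,k}` into a permutation `σ`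
(of `{1,…,n}`) at place `i`:  on the block `i ≤ x ≤ i + k - 1` it is given by
`τ (x - i + 1) + σ i - 1`, and outside this block it is `f (σ x')` where `x' = x`
for `x < i`, `x' = x - k + 1` for `x > i + k - 1`, and `f v = v` for `v ≤ σ i`,
`f v = v + k - 1` for `v > σ i`. -/
def insertPerm (k i : ℕ) (σ τ : ℕ → ℕ) : ℕ → ℕ := fun x =>
  if i ≤ x ∧ x ≤ i + k - 1 then
    τ (x - i + 1) + σ i - 1
  else
    (fun v => if v ≤ σ i then v else v + k - 1)
      (σ (if x < i then x else x - k + 1))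

/-- For permutations `σ` of `{1,…,n}` and `τ` of `{1,…,k}` and `1 ≤ i ≤ n`, one has
`σ ∘ᵢ τ = (σ ∘ᵢ id_k) ∘ (id_n ∘ᵢ τ) = (id_n ∘_{σ i} τ) ∘ (σ ∘ᵢ id_k)`
as permutations of `{1,…,n+k-1}`. -/
theorem statement0 (n k i : ℕ) (hn : 1 ≤ n) (hk : 1 ≤ k) (hi1 : 1 ≤ i) (hin : i ≤ n)
    (σ τ : ℕ → ℕ)
    (hσ : Set.BijOn σ (Set.Icc 1 n) (Set.Icc 1 n))
    (hτ : Set.BijOn τ (Set.Icc 1 k) (Set.Icc 1 k)) :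
    ∀ x ∈ Set.Icc 1 (n + k - 1),
      insertPerm k i σ τ x = insertPerm k i σ id (insertPerm k i id τ x) ∧
      insertPerm k i σ τ x = insertPerm k (σ i) id τ (insertPerm k i σ id x) ∧
      insertPerm k i σ id (insertPerm k i id τ x) =
        insertPerm k (σ i) id τ (insertPerm k i σ id x) := by
  intro x hx
  obtain ⟨hx1, hxn⟩ := hx
  have first : insertPerm k i σ τ x = insertPerm k i σ id (insertPerm k i id τ x) := by
    by_cases hblock : i ≤ x ∧ x ≤ i + k - 1
    · obtain ⟨h1, h2⟩ := hτ.mapsTo (show x - i + 1 ∈ Set.Icc 1 k from ⟨by omega, by omega⟩)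
      simp only [insertPerm, id]
      grind
    · simp only [insertPerm, id]
      grind
  have second : insertPerm k i σ τ x = insertPerm k (σ i) id τ (insertPerm k i σ id x) := by
    obtain ⟨hσi, -⟩ := hσ.mapsTo (show i ∈ Set.Icc 1 n from ⟨hi1, hin⟩)
    by_cases hblock : i ≤ x ∧ x ≤ i + k - 1
    · simp only [insertPerm, id]
      grind
    · set y := if x < i then x else x - k + 1 with hy
      have hne : σ y ≠ σ i := fun h => by
        have := hσ.injOn (show y ∈ Set.Icc 1 n from ⟨by grind, by grind⟩) ⟨hi1, hin⟩ h
        grind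
      simp only [insertPerm, id, if_neg hblock, ← hy]
      grind
  exact ⟨first, second, first.symm.trans second⟩
end

section
/- The insertion of permutations satisfies the sequential composition axiom: for permutations λ of {1,…,m}, μ of {1,…,n}, ν of {1,…,k}, and indices 1 ≤ i ≤ m, 1 ≤ j ≤ n, one has λ ∘_i (μ ∘_j ν) = (λ ∘_i μ) ∘_{j+i−1} ν as permutations of {1,…,m+n+k−2}. -/
theorem insertPerm_of_mem {k i x : ℕ} (σ τ : ℕ → ℕ) (h₁ : i ≤ x) (h₂ : x ≤ i + k - 1) :
    insertPerm k i σ τ x = τ (x - i + 1) + σ i - 1 :=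
  if_pos ⟨h₁, h₂⟩

theorem insertPerm_of_lt {k i x : ℕ} (σ τ : ℕ → ℕ) (h : x < i) :
    insertPerm k i σ τ x = if σ x ≤ σ i then σ x else σ x + k - 1 := by
  simp [insertPerm, h, Nat.not_le.mpr h]

theorem insertPerm_of_gt {k i x : ℕ} (σ τ : ℕ → ℕ) (h₁ : i ≤ x) (h₂ : i + k - 1 < x) :
    insertPerm k i σ τ x =
      if σ (x - k + 1) ≤ σ i then σ (x - k + 1) else σ (x - k + 1) + k - 1 := by
  simp [insertPerm, Nat.not_lt.mpr h₁, Nat.not_le.mpr h₂]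

/-- Sequential composition axiom for insertion of permutations:
`λ ∘ᵢ (μ ∘ⱼ ν) = (λ ∘ᵢ μ) ∘_{j+i-1} ν` as permutations of `{1,…,m+n+k-2}`. -/
theorem statement2 (m n k i j : ℕ) (hm : 1 ≤ m) (hn : 1 ≤ n) (hk : 1 ≤ k)
    (hi1 : 1 ≤ i) (him : i ≤ m) (hj1 : 1 ≤ j) (hjn : j ≤ n)
    (lam μ ν : ℕ → ℕ)
    (hlam : Set.BijOn lam (Set.Icc 1 m) (Set.Icc 1 m))
    (hμ : Set.BijOn μ (Set.Icc 1 n) (Set.Icc 1 n))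
    (hν : Set.BijOn ν (Set.Icc 1 k) (Set.Icc 1 k)) :
    ∀ x ∈ Set.Icc 1 (m + n + k - 2),
      insertPerm (n + k - 1) i lam (insertPerm k j μ ν) x =
        insertPerm k (j + i - 1) (insertPerm n i lam μ) ν x := by
  rintro x ⟨hx1, hx2⟩
  have hμj : 1 ≤ μ j ∧ μ j ≤ n := hμ.mapsTo ⟨hj1, hjn⟩
  have hmid : insertPerm n i lam μ (j + i - 1) = μ j + lam i - 1 := by
    rw [insertPerm_of_mem lam μ (by omega) (by omega), show j + i - 1 - i + 1 = j by omega]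
  rcases lt_or_ge x i with hxi | hxi
  · rw [insertPerm_of_lt lam _ hxi, insertPerm_of_lt _ ν (by omega), hmid,
      insertPerm_of_lt lam μ hxi]
    split_ifs <;> omega
  rcases lt_or_ge (i + (n + k - 1) - 1) x with hxr | hxr
  · rw [insertPerm_of_gt lam _ hxi hxr, insertPerm_of_gt _ ν (by omega) (by omega), hmid,
      insertPerm_of_gt lam μ (by omega) (by omega),
      show x - k + 1 - n + 1 = x - (n + k - 1) + 1 by omega]
    split_ifs <;> omega
  rw [insertPerm_of_mem lam _ hxi hxr]
  rcases lt_or_ge x (j + i - 1) with hxj | hxj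
  · have hy : 1 ≤ μ (x - i + 1) ∧ μ (x - i + 1) ≤ n := hμ.mapsTo ⟨by omega, by omega⟩
    rw [insertPerm_of_lt μ ν (by omega), insertPerm_of_lt _ ν hxj, hmid,
      insertPerm_of_mem lam μ hxi (by omega)]
    split_ifs <;> omega
  rcases lt_or_ge (j + i - 1 + k - 1) x with hxk | hxk
  · have hy : 1 ≤ μ (x - i + 1 - k + 1) ∧ μ (x - i + 1 - k + 1) ≤ n :=
      hμ.mapsTo ⟨by omega, by omega⟩
    rw [insertPerm_of_gt μ ν (by omega) (by omega), insertPerm_of_gt _ ν hxj hxk, hmid,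
      insertPerm_of_mem lam μ (by omega) (by omega),
      show x - k + 1 - i + 1 = x - i + 1 - k + 1 by omega]
    split_ifs <;> omega
  · rw [insertPerm_of_mem μ ν (by omega) (by omega), insertPerm_of_mem _ ν hxj hxk, hmid,
      show x - i + 1 - j + 1 = x - (j + i - 1) + 1 by omega]
    omega
end

section
/- The insertion of permutations is equivariant in its second argument: for a permutation σ of {1,…,n}, permutations τ, ω of {1,…,k}, and 1 ≤ i ≤ n, one has σ ∘_i (τ ∘ ω) = (σ ∘_i τ) ∘ (id_n ∘_i ω), where ∘ between permutations denotes composition of functions. -/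
theorem insertPerm_id_of_mem_block {k i x : ℕ} {ω : ℕ → ℕ}
    (hω : Set.MapsTo ω (Set.Icc 1 k) (Set.Icc 1 k)) (hx : i ≤ x ∧ x ≤ i + k - 1)
    (hk : 1 ≤ k) :
    insertPerm k i id ω x = ω (x - i + 1) + i - 1 ∧
      1 ≤ ω (x - i + 1) ∧ ω (x - i + 1) ≤ k := by
  have h : x - i + 1 ∈ Set.Icc 1 k := ⟨by omega, by omega⟩
  exact ⟨by simp [insertPerm, hx], hω h⟩

theorem insertPerm_id_of_notMem_block {k i x : ℕ} {ω : ℕ → ℕ}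
    (hx : ¬(i ≤ x ∧ x ≤ i + k - 1)) (hk : 1 ≤ k) :
    insertPerm k i id ω x = x := by
  simp only [insertPerm, if_neg hx, id]
  split_ifs <;> omega

/-- Equivariance of insertion in the second argument:
`σ ∘ᵢ (τ ∘ ω) = (σ ∘ᵢ τ) ∘ (id_n ∘ᵢ ω)` as permutations of `{1,…,n+k-1}`. -/
theorem statement4 (n k i : ℕ) (hn : 1 ≤ n) (hk : 1 ≤ k) (hi1 : 1 ≤ i) (hin : i ≤ n)
    (σ τ ω : ℕ → ℕ)
    (hσ : Set.BijOn σ (Set.Icc 1 n) (Set.Icc 1 n))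
    (hτ : Set.BijOn τ (Set.Icc 1 k) (Set.Icc 1 k))
    (hω : Set.BijOn ω (Set.Icc 1 k) (Set.Icc 1 k)) :
    ∀ x ∈ Set.Icc 1 (n + k - 1),
      insertPerm k i σ (τ ∘ ω) x = insertPerm k i σ τ (insertPerm k i id ω x) := by
  intro x _
  by_cases hx : i ≤ x ∧ x ≤ i + k - 1
  · obtain ⟨h, h1, h2⟩ := insertPerm_id_of_mem_block hω.mapsTo hx hk
    have hy : i ≤ ω (x - i + 1) + i - 1 ∧ ω (x - i + 1) + i - 1 ≤ i + k - 1 := by omega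
    have hsub : ω (x - i + 1) + i - 1 - i + 1 = ω (x - i + 1) := by omega
    rw [h]
    simp only [insertPerm, if_pos hx, if_pos hy, hsub, Function.comp_apply]
  · rw [insertPerm_id_of_notMem_block hx hk]
    simp only [insertPerm, if_neg hx]
end

section
/- The insertion of permutations is equivariant in its first argument: for permutations σ, ρ of {1,…,n}, a permutation τ of {1,…,k}, and 1 ≤ i ≤ n, one has (σ ∘ ρ) ∘_i τ = (σ ∘_{ρ(i)} τ) ∘ (ρ ∘_i id_k), where ∘ between permutations denotes composition of functions. -/
/-- Equivariance of insertion in the first argument: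
`(σ ∘ ρ) ∘ᵢ τ = (σ ∘_{ρ i} τ) ∘ (ρ ∘ᵢ id_k)` as permutations of `{1,…,n+k-1}`. -/
theorem statement5 (n k i : ℕ) (hn : 1 ≤ n) (hk : 1 ≤ k) (hi1 : 1 ≤ i) (hin : i ≤ n)
    (σ ρ τ : ℕ → ℕ)
    (hσ : Set.BijOn σ (Set.Icc 1 n) (Set.Icc 1 n))
    (hρ : Set.BijOn ρ (Set.Icc 1 n) (Set.Icc 1 n))
    (hτ : Set.BijOn τ (Set.Icc 1 k) (Set.Icc 1 k)) :
    ∀ x ∈ Set.Icc 1 (n + k - 1),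
      insertPerm k i (σ ∘ ρ) τ x = insertPerm k (ρ i) σ τ (insertPerm k i ρ id x) := by
  rintro x ⟨hx1, hx2⟩
  obtain ⟨hρi, -⟩ := hρ.mapsTo ⟨hi1, hin⟩
  by_cases hx : i ≤ x ∧ x ≤ i + k - 1
  · have hy : ρ i ≤ x - i + 1 + ρ i - 1 ∧ x - i + 1 + ρ i - 1 ≤ ρ i + k - 1 := by omega
    have hxy : x - i + 1 + ρ i - 1 - ρ i + 1 = x - i + 1 := by omega
    simp only [insertPerm, if_pos hx, id, if_pos hy, hxy, Function.comp]
  · simp only [insertPerm, if_neg hx, Function.comp]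
    generalize hz : (if x < i then x else x - k + 1) = z
    have hzmem : z ∈ Set.Icc 1 n ∧ z ≠ i := by
      simp only [Set.mem_Icc]
      split_ifs at hz <;> omega
    have hne : ρ z ≠ ρ i := fun h => hzmem.2 (hρ.injOn hzmem.1 ⟨hi1, hin⟩ h)
    rcases lt_or_gt_of_ne hne with h | h
    · have hy : ¬ (ρ i ≤ ρ z ∧ ρ z ≤ ρ i + k - 1) := by omega
      simp only [if_pos h.le, if_neg hy, if_pos h]
    · have hy : ¬ (ρ i ≤ ρ z + k - 1 ∧ ρ z + k - 1 ≤ ρ i + k - 1) := by omega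
      have hlt : ¬ ρ z + k - 1 < ρ i := by omega
      have hback : ρ z + k - 1 - k + 1 = ρ z := by omega
      simp only [if_neg h.not_ge, if_neg hy, if_neg hlt, hback]
end

section
/- Let R be a ring and let f : P → Q be a morphism of ℕ-indexed chain complexes of R-modules (with differentials d : P_{n+1} → P_n, d : Q_{n+1} → Q_n and d∘d = 0). Then f is a quasi-isomorphism with f_n : P_n → Q_n surjective for all n if and only if: (a) f_0 is surjective, and (b) for every n ≥ 0, every q ∈ Q_{n+1} and every p ∈ P_n satisfying d_P(p) = 0 when n ≥ 1 (no condition on p when n = 0) and f_n(p) = d_Q(q), there exists x ∈ P_{n+1} with f_{n+1}(x) = q and d_P(x) = p. -/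
open CategoryTheory

namespace CategoryTheory.ShortComplex

universe v u

variable {R : Type u} [Ring R] {S T : ShortComplex (ModuleCat.{v} R)}

lemma moduleCat_exists_iCycles_eq (x : S.X₂) (hx : S.g x = 0) :
    ∃ c : S.cycles, S.iCycles c = x :=
  (moduleCat_exact_iff (.mk S.iCycles S.g S.iCycles_g)).1
    (exact_of_f_is_kernel _ S.cyclesIsKernel) x hx

lemma moduleCat_iCycles_injective : Function.Injective S.iCycles :=
  (ModuleCat.mono_iff_injective _).1 inferInstance

lemma moduleCat_homologyπ_surjective : Function.Surjective S.homologyπ :=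
  (ModuleCat.epi_iff_surjective _).1 inferInstance

lemma moduleCat_homologyπ_eq_zero_iff (c : S.cycles) :
    S.homologyπ c = 0 ↔ ∃ z : S.X₁, S.f z = S.iCycles c := by
  constructor
  · intro hc
    obtain ⟨z, hz⟩ := (moduleCat_exact_iff (.mk S.toCycles S.homologyπ S.toCycles_comp_homologyπ)).1
      (exact_of_g_is_cokernel _ S.homologyIsCokernel) c hc
    exact ⟨z, by rw [← hz]; exact ConcreteCategory.congr_hom S.toCycles_i.symm z⟩
  · rintro ⟨z, hz⟩
    have hc : S.toCycles z = c :=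
      moduleCat_iCycles_injective ((ConcreteCategory.congr_hom S.toCycles_i z).trans hz)
    rw [← hc]
    exact ConcreteCategory.congr_hom S.toCycles_comp_homologyπ z

/-- A morphism of short complexes of modules is a quasi-isomorphism if and only if it reflects
boundaries among cycles and every cycle of the target is homologous to the image of a cycle. -/
lemma moduleCat_quasiIso_iff (φ : S ⟶ T) :
    QuasiIso φ ↔
      (∀ x : S.X₂, S.g x = 0 → (∃ z, T.f z = φ.τ₂ x) → ∃ z, S.f z = x) ∧
      (∀ y : T.X₂, T.g y = 0 → ∃ x : S.X₂, S.g x = 0 ∧ ∃ z, T.f z = φ.τ₂ x - y) := by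
  have hi (c : S.cycles) : T.iCycles (cyclesMap φ c) = φ.τ₂ (S.iCycles c) :=
    ConcreteCategory.congr_hom (cyclesMap_i φ) c
  have hπ (c : S.cycles) : homologyMap φ (S.homologyπ c) = T.homologyπ (cyclesMap φ c) :=
    ConcreteCategory.congr_hom (homologyπ_naturality φ) c
  have hg (c : S.cycles) : S.g (S.iCycles c) = 0 := ConcreteCategory.congr_hom S.iCycles_g c
  have hgT (c : T.cycles) : T.g (T.iCycles c) = 0 := ConcreteCategory.congr_hom T.iCycles_g c
  rw [quasiIso_iff, ConcreteCategory.isIso_iff_bijective]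
  refine and_congr ?_ ?_
  · rw [injective_iff_map_eq_zero]
    constructor
    · rintro h x hx ⟨z, hz⟩
      obtain ⟨c, rfl⟩ := moduleCat_exists_iCycles_eq x hx
      refine (moduleCat_homologyπ_eq_zero_iff c).1 (h _ ?_)
      rw [hπ, moduleCat_homologyπ_eq_zero_iff, hi]
      exact ⟨z, hz⟩
    · intro h a ha
      obtain ⟨c, rfl⟩ := moduleCat_homologyπ_surjective a
      rw [hπ, moduleCat_homologyπ_eq_zero_iff, hi] at ha
      exact (moduleCat_homologyπ_eq_zero_iff c).2 (h _ (hg c) ha)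
  · constructor
    · intro h y hy
      obtain ⟨c, rfl⟩ := moduleCat_exists_iCycles_eq y hy
      obtain ⟨a, ha⟩ := h (T.homologyπ c)
      obtain ⟨b, rfl⟩ := moduleCat_homologyπ_surjective a
      refine ⟨S.iCycles b, hg b, ?_⟩
      rw [← hi, ← map_sub, ← moduleCat_homologyπ_eq_zero_iff, map_sub, ← hπ, ha, sub_self]
    · intro h a
      obtain ⟨c, rfl⟩ := moduleCat_homologyπ_surjective a
      obtain ⟨x, hx, hz⟩ := h _ (hgT c)
      obtain ⟨b, rfl⟩ := moduleCat_exists_iCycles_eq x hx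
      refine ⟨S.homologyπ b, ?_⟩
      rwa [← hi, ← map_sub, ← moduleCat_homologyπ_eq_zero_iff, map_sub, ← hπ, sub_eq_zero] at hz

end CategoryTheory.ShortComplex

namespace ChainComplex

universe v u

variable {R : Type u} [Ring R] {P Q : ChainComplex (ModuleCat.{v} R) ℕ}

lemma moduleCat_quasiIso_iff (f : P ⟶ Q) :
    QuasiIso f ↔ ∀ n : ℕ,
      (∀ x : P.X n, P.d n (n - 1) x = 0 → (∃ z, Q.d (n + 1) n z = f.f n x) →
        ∃ z, P.d (n + 1) n z = x) ∧
      (∀ y : Q.X n, Q.d n (n - 1) y = 0 →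
        ∃ x : P.X n, P.d n (n - 1) x = 0 ∧ ∃ z, Q.d (n + 1) n z = f.f n x - y) := by
  rw [quasiIso_iff]
  refine forall_congr' fun n => ?_
  rw [quasiIsoAt_iff' f (n + 1) n (n - 1) (by simp) (by cases n <;> simp)]
  exact ShortComplex.moduleCat_quasiIso_iff _

lemma moduleCat_d_d_apply (P : ChainComplex (ModuleCat.{v} R) ℕ) (i j k : ℕ) (x : P.X i) :
    P.d j k (P.d i j x) = 0 :=
  ConcreteCategory.congr_hom (P.d_comp_d i j k) x

lemma moduleCat_f_d_apply (f : P ⟶ Q) (i j : ℕ) (x : P.X i) :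
    f.f j (P.d i j x) = Q.d i j (f.f i x) :=
  ConcreteCategory.congr_hom ((f.comm i j).symm) x

lemma moduleCat_d_self_pred_apply_eq_zero_iff (n : ℕ) (x : P.X n) :
    P.d n (n - 1) x = 0 ↔ (1 ≤ n → P.d n (n - 1) x = 0) := by
  refine ⟨fun h _ => h, fun h => ?_⟩
  rcases Nat.eq_zero_or_pos n with rfl | hn
  · exact ConcreteCategory.congr_hom (P.shape 0 (0 - 1) (by simp)) x
  · exact h hn

/-- If every pair of a cycle `p` and an element `q` with `f p = d q` has a common lift, then a
morphism surjective in degree `0` is surjective on cycles. -/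
lemma moduleCat_exists_cycle_lift {f : P ⟶ Q} (h₀ : Function.Surjective (f.f 0))
    (h : ∀ (n : ℕ) (q : Q.X (n + 1)) (p : P.X n), P.d n (n - 1) p = 0 →
      f.f n p = Q.d (n + 1) n q → ∃ x : P.X (n + 1), f.f (n + 1) x = q ∧ P.d (n + 1) n x = p)
    (n : ℕ) (y : Q.X n) (hy : Q.d n (n - 1) y = 0) :
    ∃ x : P.X n, f.f n x = y ∧ P.d n (n - 1) x = 0 := by
  cases n with
  | zero =>
    obtain ⟨x, hx⟩ := h₀ y
    exact ⟨x, hx, (moduleCat_d_self_pred_apply_eq_zero_iff 0 x).2 (by simp)⟩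
  | succ n => exact h n y 0 (map_zero _) (by rw [map_zero]; exact hy.symm)

end ChainComplex

/-- A morphism `f : P → Q` of `ℕ`-indexed chain complexes of modules over a ring `R`
is a quasi-isomorphism with each `f_n` surjective if and only if `f_0` is surjective
and, for every `n`, every `q ∈ Q_{n+1}` and every `p ∈ P_n` which is a cycle when
`n ≥ 1` (no condition when `n = 0`) with `f_n p = d_Q q`, there exists
`x ∈ P_{n+1}` with `f_{n+1} x = q` and `d_P x = p`. -/
theorem statement10 (R : Type*) [Ring R]
    (P Q : ChainComplex (ModuleCat R) ℕ) (f : P ⟶ Q) :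
    (QuasiIso f ∧ ∀ n : ℕ, Function.Surjective (f.f n)) ↔
    (Function.Surjective (f.f 0) ∧
      ∀ (n : ℕ) (q : Q.X (n + 1)) (p : P.X n),
        (1 ≤ n → P.d n (n - 1) p = 0) → f.f n p = Q.d (n + 1) n q →
        ∃ x : P.X (n + 1), f.f (n + 1) x = q ∧ P.d (n + 1) n x = p) := by
  simp_rw [← ChainComplex.moduleCat_d_self_pred_apply_eq_zero_iff,
    ChainComplex.moduleCat_quasiIso_iff]
  constructor
  · rintro ⟨hf, hs⟩
    refine ⟨hs 0, fun n q p hp hpq => ?_⟩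
    obtain ⟨z, rfl⟩ := (hf n).1 p hp ⟨q, hpq.symm⟩
    obtain ⟨x, hx, w, hw⟩ := (hf (n + 1)).2 (q - f.f (n + 1) z) (by
      rw [map_sub, Nat.add_sub_cancel, ← hpq, ChainComplex.moduleCat_f_d_apply, sub_self])
    obtain ⟨w, rfl⟩ := hs (n + 2) w
    rw [Nat.add_sub_cancel] at hx
    refine ⟨z + x - P.d (n + 2) (n + 1) w, ?_, ?_⟩
    · rw [map_sub, map_add, ChainComplex.moduleCat_f_d_apply, hw]
      abel
    · rw [map_sub, map_add, hx, ChainComplex.moduleCat_d_d_apply, add_zero, sub_zero]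
  · rintro ⟨h₀, h⟩
    have hc := ChainComplex.moduleCat_exists_cycle_lift h₀ h
    refine ⟨fun n => ⟨fun x hx ⟨z, hz⟩ => ?_, fun y hy => ?_⟩, fun n => ?_⟩
    · obtain ⟨w, -, hw⟩ := h n z x hx hz.symm
      exact ⟨w, hw⟩
    · obtain ⟨x, rfl, hx⟩ := hc n y hy
      exact ⟨x, hx, 0, by rw [map_zero, sub_self]⟩
    · cases n with
      | zero => exact h₀
      | succ n =>
        intro q
        obtain ⟨p, hpq, hp⟩ := hc n (Q.d (n + 1) n q) (ChainComplex.moduleCat_d_d_apply Q _ _ _ q)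
        obtain ⟨x, hx, -⟩ := h n q p hp hpq
        exact ⟨x, hx⟩
end

section
/- Let K be a commutative ring and G a group, and write X = { g ∈ G : g ≠ 1 }. Let B be the quotient of the free (tensor) K-algebra on X by the two-sided ideal generated by the elements ι(g)·ι(g⁻¹) − ι(g) − ι(g⁻¹) for g ∈ X, and ι(g)·ι(h) − ι(g) − ι(h) + ι(g·h) for g, h ∈ X with g·h ≠ 1. Then the assignment ι(g) ↦ 1 − g induces a K-algebra isomorphism from B onto the group algebra K[G]. -/
/-- The relations of the quadratic-linear ("linearized") presentation of the group
algebra: `ι g * ι g⁻¹ ∼ ι g + ι g⁻¹` for `g ≠ 1`, and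
`ι g * ι h ∼ ι g + ι h − ι (g * h)` for `g, h ≠ 1` with `g * h ≠ 1`, inside the free
algebra on `X = {g ∈ G : g ≠ 1}`. -/
inductive GroupAlgebraRelLin (K G : Type*) [CommRing K] [Group G] :
    FreeAlgebra K {g : G // g ≠ 1} → FreeAlgebra K {g : G // g ≠ 1} → Prop
  | inv (g : {g : G // g ≠ 1}) :
      GroupAlgebraRelLin K G
        (FreeAlgebra.ι K g * FreeAlgebra.ι K
          (⟨(g : G)⁻¹, fun h => g.2 (inv_eq_one.mp h)⟩ : {g : G // g ≠ 1}))
        (FreeAlgebra.ι K g + FreeAlgebra.ι K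
          (⟨(g : G)⁻¹, fun h => g.2 (inv_eq_one.mp h)⟩ : {g : G // g ≠ 1}))
  | mul (g h : {g : G // g ≠ 1}) (hgh : (g : G) * (h : G) ≠ 1) :
      GroupAlgebraRelLin K G
        (FreeAlgebra.ι K g * FreeAlgebra.ι K h)
        (FreeAlgebra.ι K g + FreeAlgebra.ι K h -
          FreeAlgebra.ι K (⟨(g : G) * (h : G), hgh⟩ : {g : G // g ≠ 1}))

namespace GroupAlgebraRelLin

variable (K G : Type*) [CommRing K] [Group G]

open Classical in
/-- The class of `ι g` in the quotient, extended by `0` at `g = 1`. -/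
noncomputable def gen (g : G) : RingQuot (GroupAlgebraRelLin K G) :=
  if h : g = 1 then 0 else RingQuot.mkAlgHom K (GroupAlgebraRelLin K G) (FreeAlgebra.ι K ⟨g, h⟩)

@[simp]
theorem gen_one : gen K G 1 = 0 := by simp [gen]

theorem gen_coe (g : {g : G // g ≠ 1}) :
    gen K G g = RingQuot.mkAlgHom K (GroupAlgebraRelLin K G) (FreeAlgebra.ι K g) := by
  simp [gen, g.2]

theorem gen_mul (g h : G) :
    gen K G (g * h) = gen K G g + gen K G h - gen K G g * gen K G h := by
  by_cases hg : g = 1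
  · simp [hg]
  by_cases hh : h = 1
  · simp [hh]
  by_cases hgh : g * h = 1
  · obtain rfl := eq_inv_of_mul_eq_one_right hgh
    have key := RingQuot.mkAlgHom_rel K (GroupAlgebraRelLin.inv (K := K) ⟨g, hg⟩)
    simp only [map_mul, map_add, ← gen_coe] at key
    simp [key]
  · have key := RingQuot.mkAlgHom_rel K (GroupAlgebraRelLin.mul (K := K) ⟨g, hg⟩ ⟨h, hh⟩ hgh)
    simp only [map_mul, map_add, map_sub, ← gen_coe] at key
    simp [key]

/-- The multiplicative map `g ↦ 1 - ι g` from the group to the quotient. -/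
noncomputable def oneSubGen : G →* RingQuot (GroupAlgebraRelLin K G) where
  toFun g := 1 - gen K G g
  map_one' := by simp
  map_mul' g h := by
    simp only [gen_mul, mul_sub, sub_mul, mul_one, one_mul]
    abel

/-- The algebra map from the quotient to the group algebra sending `ι g` to `1 - g`. -/
noncomputable def toMonoidAlgebra :
    RingQuot (GroupAlgebraRelLin K G) →ₐ[K] MonoidAlgebra K G :=
  RingQuot.liftAlgHom K
    ⟨FreeAlgebra.lift K fun g : {g : G // g ≠ 1} => 1 - MonoidAlgebra.of K G (g : G), by
      rintro _ _ (⟨g⟩ | ⟨g, h, hgh⟩)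
      · have key : MonoidAlgebra.of K G (g : G) * MonoidAlgebra.of K G (g : G)⁻¹ = 1 := by
          rw [← map_mul, mul_inv_cancel, map_one]
        simp only [map_mul, map_add, FreeAlgebra.lift_ι_apply, mul_sub, sub_mul, key, mul_one,
          one_mul]
        abel
      · simp only [map_mul, map_add, map_sub, FreeAlgebra.lift_ι_apply, mul_sub, sub_mul, mul_one,
          one_mul]
        abel⟩

theorem toMonoidAlgebra_mkAlgHom_ι (g : {g : G // g ≠ 1}) :
    toMonoidAlgebra K G (RingQuot.mkAlgHom K (GroupAlgebraRelLin K G) (FreeAlgebra.ι K g)) =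
      1 - MonoidAlgebra.of K G (g : G) := by
  rw [toMonoidAlgebra, RingQuot.liftAlgHom_mkAlgHom_apply, FreeAlgebra.lift_ι_apply]

theorem toMonoidAlgebra_gen (g : G) :
    toMonoidAlgebra K G (gen K G g) = 1 - MonoidAlgebra.of K G g := by
  by_cases hg : g = 1
  · rw [hg, gen_one, map_zero, map_one, sub_self]
  · exact (congrArg _ (gen_coe K G ⟨g, hg⟩)).trans (toMonoidAlgebra_mkAlgHom_ι K G ⟨g, hg⟩)

/-- The quotient by the quadratic-linear relations is the group algebra. -/
noncomputable def equivMonoidAlgebra :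
    RingQuot (GroupAlgebraRelLin K G) ≃ₐ[K] MonoidAlgebra K G :=
  AlgEquiv.ofAlgHom (toMonoidAlgebra K G) (MonoidAlgebra.lift K _ G (oneSubGen K G))
    (by
      refine MonoidAlgebra.algHom_ext' (MonoidHom.ext fun g => ?_)
        (Subsingleton.elim _ _)
      simp only [MonoidHom.comp_apply, MonoidHom.coe_coe, AlgHom.comp_apply,
        MonoidAlgebra.lift_of, AlgHom.id_apply]
      change toMonoidAlgebra K G (1 - gen K G g) = _
      rw [map_sub, map_one, toMonoidAlgebra_gen, sub_sub_cancel])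
    (by
      refine RingQuot.ringQuot_ext' K _ _ (FreeAlgebra.hom_ext (funext fun g => ?_))
      simp only [Function.comp_apply, AlgHom.comp_apply, AlgHom.id_apply]
      rw [toMonoidAlgebra_mkAlgHom_ι, map_sub, map_one, MonoidAlgebra.lift_of, ← gen_coe]
      exact sub_sub_cancel _ _)

end GroupAlgebraRelLin

/-- The quotient of the free `K`-algebra on `X = {g ∈ G : g ≠ 1}` by the two-sided
ideal generated by `ι g · ι g⁻¹ − ι g − ι g⁻¹` (for `g ∈ X`) and
`ι g · ι h − ι g − ι h + ι (g·h)` (for `g, h ∈ X` with `g·h ≠ 1`) is isomorphic, as a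
`K`-algebra, to the group algebra `K[G]`, via the assignment `ι g ↦ 1 − g`. -/
theorem statement12 (K G : Type*) [CommRing K] [Group G] :
    ∃ e : RingQuot (GroupAlgebraRelLin K G) ≃ₐ[K] MonoidAlgebra K G,
      ∀ g : {g : G // g ≠ 1},
        e (RingQuot.mkAlgHom K (GroupAlgebraRelLin K G) (FreeAlgebra.ι K g)) =
          1 - MonoidAlgebra.of K G (g : G) := by
  exact ⟨GroupAlgebraRelLin.equivMonoidAlgebra K G,
    GroupAlgebraRelLin.toMonoidAlgebra_mkAlgHom_ι K G⟩
end

section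
/- Let K be a commutative ring and G a group, and write X = { g ∈ G : g ≠ 1 }. Let A be the quotient of the free K-algebra on X by the two-sided ideal generated by ι(g)·ι(g⁻¹) − 1 for g ∈ X and ι(g)·ι(h) − ι(g·h) for g, h ∈ X with g·h ≠ 1, and let B be the quotient of the free K-algebra on X by the two-sided ideal generated by ι(g)·ι(g⁻¹) − ι(g) − ι(g⁻¹) for g ∈ X and ι(g)·ι(h) − ι(g) − ι(h) + ι(g·h) for g, h ∈ X with g·h ≠ 1. Then the assignment ι(g) ↦ 1 − ι(g) induces a well-defined K-algebra isomorphism from B onto A, whose inverse is induced by the assignment ι(g) ↦ 1 − ι(g) from A to B. -/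
/-- The relations of the set-theoretical quadratic-linear-constant presentation of the
group algebra: `ι g * ι g⁻¹ ∼ 1`, and `ι g * ι h ∼ ι (g * h)` when `g * h ≠ 1`. -/
inductive GroupAlgebraRel (K G : Type*) [CommRing K] [Group G] :
    FreeAlgebra K {g : G // g ≠ 1} → FreeAlgebra K {g : G // g ≠ 1} → Prop
  | inv (g : {g : G // g ≠ 1}) :
      GroupAlgebraRel K G
        (FreeAlgebra.ι K g * FreeAlgebra.ι K
          (⟨(g : G)⁻¹, fun h => g.2 (inv_eq_one.mp h)⟩ : {g : G // g ≠ 1}))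
        1
  | mul (g h : {g : G // g ≠ 1}) (hgh : (g : G) * (h : G) ≠ 1) :
      GroupAlgebraRel K G
        (FreeAlgebra.ι K g * FreeAlgebra.ι K h)
        (FreeAlgebra.ι K (⟨(g : G) * (h : G), hgh⟩ : {g : G // g ≠ 1}))

namespace GroupAlgebraPresentation

/-- The homomorphism on the free algebra sending `ι g` to `1 - ι g` in the quotient by `r`. -/
noncomputable def oneSubLift {K X : Type*} [CommRing K]
    (r : FreeAlgebra K X → FreeAlgebra K X → Prop) : FreeAlgebra K X →ₐ[K] RingQuot r :=
  FreeAlgebra.lift K fun x => 1 - RingQuot.mkAlgHom K r (FreeAlgebra.ι K x)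

@[simp]
theorem oneSubLift_ι {K X : Type*} [CommRing K]
    (r : FreeAlgebra K X → FreeAlgebra K X → Prop) (x : X) :
    oneSubLift r (FreeAlgebra.ι K x) = 1 - RingQuot.mkAlgHom K r (FreeAlgebra.ι K x) :=
  FreeAlgebra.lift_ι_apply _ _

variable (K G : Type*) [CommRing K] [Group G]

theorem oneSubLift_eq_of_linRel {x y : FreeAlgebra K {g : G // g ≠ 1}}
    (h : GroupAlgebraRelLin K G x y) :
    oneSubLift (GroupAlgebraRel K G) x = oneSubLift (GroupAlgebraRel K G) y := by
  cases h with
  | inv g =>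
    have := RingQuot.mkAlgHom_rel K (GroupAlgebraRel.inv (K := K) g)
    rw [map_mul, map_one] at this
    simp only [map_mul, map_add, oneSubLift_ι, mul_sub, sub_mul, one_mul, mul_one, this]
    abel
  | mul g h hgh =>
    have := RingQuot.mkAlgHom_rel K (GroupAlgebraRel.mul (K := K) g h hgh)
    rw [map_mul] at this
    simp only [map_mul, map_add, map_sub, oneSubLift_ι, mul_sub, sub_mul, one_mul, mul_one, this]
    abel

theorem oneSubLift_eq_of_rel {x y : FreeAlgebra K {g : G // g ≠ 1}}
    (h : GroupAlgebraRel K G x y) :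
    oneSubLift (GroupAlgebraRelLin K G) x = oneSubLift (GroupAlgebraRelLin K G) y := by
  cases h with
  | inv g =>
    have := RingQuot.mkAlgHom_rel K (GroupAlgebraRelLin.inv (K := K) g)
    rw [map_mul, map_add] at this
    simp only [map_mul, map_one, oneSubLift_ι, mul_sub, sub_mul, one_mul, mul_one, this]
    abel
  | mul g h hgh =>
    have := RingQuot.mkAlgHom_rel K (GroupAlgebraRelLin.mul (K := K) g h hgh)
    rw [map_mul, map_sub, map_add] at this
    simp only [map_mul, oneSubLift_ι, mul_sub, sub_mul, one_mul, mul_one, this]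
    abel

/-- The isomorphism from the linearized presentation to the set-theoretical one. -/
noncomputable def equiv :
    RingQuot (GroupAlgebraRelLin K G) ≃ₐ[K] RingQuot (GroupAlgebraRel K G) :=
  AlgEquiv.ofAlgHom
    (RingQuot.liftAlgHom K ⟨oneSubLift _, fun _ _ => oneSubLift_eq_of_linRel K G⟩)
    (RingQuot.liftAlgHom K ⟨oneSubLift _, fun _ _ => oneSubLift_eq_of_rel K G⟩)
    (by
      ext g
      simp)
    (by
      ext g
      simp)

end GroupAlgebraPresentation

/-- The assignment `ι g ↦ 1 − ι g` induces a well-defined `K`-algebra isomorphism from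
the quotient `B` of the free algebra on `X = {g ∈ G : g ≠ 1}` by the linearized
relations onto the quotient `A` by the set-theoretical relations, whose inverse is
likewise induced by the assignment `ι g ↦ 1 − ι g`. -/
theorem statement14 (K G : Type*) [CommRing K] [Group G] :
    ∃ e : RingQuot (GroupAlgebraRelLin K G) ≃ₐ[K] RingQuot (GroupAlgebraRel K G),
      (∀ g : {g : G // g ≠ 1},
        e (RingQuot.mkAlgHom K (GroupAlgebraRelLin K G) (FreeAlgebra.ι K g)) =
          1 - RingQuot.mkAlgHom K (GroupAlgebraRel K G) (FreeAlgebra.ι K g)) ∧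
      (∀ g : {g : G // g ≠ 1},
        e.symm (RingQuot.mkAlgHom K (GroupAlgebraRel K G) (FreeAlgebra.ι K g)) =
          1 - RingQuot.mkAlgHom K (GroupAlgebraRelLin K G) (FreeAlgebra.ι K g)) := by
  exact ⟨GroupAlgebraPresentation.equiv K G,
    fun _ => by simp [GroupAlgebraPresentation.equiv],
    fun _ => by simp [GroupAlgebraPresentation.equiv]⟩
end
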